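/- Let j and k be natural numbers and let w and δ be real numbers with w ≥ (4/5)·10^(−j) and 0 ≤ δ ≤ 18·10^(−(j+k)). Then the information loss satisfies log₁₀(w + δ) − log₁₀(w) ≤ log₁₀(1 + (45/2)·10^(−k)) ≤ (45/2)·10^(−k)/ln 10. -/

import Mathlib

/-- Quantitative Rule of One Tenth: if `w ≥ (4/5) * 10^(-j)` and
`0 ≤ δ ≤ 18 * 10^(-(j+k))`, then the information loss
`log₁₀(w + δ) - log₁₀ w` is at most `log₁₀(1 + (45/2) * 10^(-k))`, which is at
most `(45/2) * 10^(-k) / ln 10`. -/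
theorem rule_of_one_tenth (j k : ℕ) (w δ : ℝ)
    (hw : w ≥ (4 / 5 : ℝ) * (10 : ℝ) ^ (-(j : ℤ)))
    (hδ0 : 0 ≤ δ) (hδ : δ ≤ 18 * (10 : ℝ) ^ (-((j : ℤ) + (k : ℤ)))) :
    Real.logb 10 (w + δ) - Real.logb 10 w ≤
        Real.logb 10 (1 + (45 / 2 : ℝ) * (10 : ℝ) ^ (-(k : ℤ))) ∧
      Real.logb 10 (1 + (45 / 2 : ℝ) * (10 : ℝ) ^ (-(k : ℤ))) ≤
        (45 / 2 : ℝ) * (10 : ℝ) ^ (-(k : ℤ)) / Real.log 10 := by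
  have ha : (0 : ℝ) < (10 : ℝ) ^ (-(j : ℤ)) := by positivity
  have hb : (0 : ℝ) < (10 : ℝ) ^ (-(k : ℤ)) := by positivity
  rw [neg_add, zpow_add₀ (by norm_num : (10 : ℝ) ≠ 0)] at hδ
  generalize (10 : ℝ) ^ (-(j : ℤ)) = a at *
  generalize (10 : ℝ) ^ (-(k : ℤ)) = b at *
  have hw0 : 0 < w := by linarith
  constructor
  · rw [sub_le_iff_le_add, ← Real.logb_mul (by positivity) (by positivity)]
    apply Real.logb_le_logb_of_le (by norm_num) (by positivity)
    nlinarith [mul_le_mul_of_nonneg_right hw hb.le]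
  · have hl : 0 < Real.log 10 := Real.log_pos (by norm_num)
    have h := Real.log_le_sub_one_of_pos (show 0 < 1 + (45 / 2 : ℝ) * b by positivity)
    rw [Real.logb]
    exact div_le_div_of_nonneg_right (by linarith) hl.le
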